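/- arXiv:2006.15484 — 3 statements merged into one kernel-verified Lean document; each statement's English description precedes it below -/
import Mathlib

section
/- Let n ≥ 1 and N ∈ ℕ. For each subset I ⊆ Fin n let H_I : (Fin n → ℤ) → ℤ be a function, and define h'(s) = Σ_{I ⊆ Fin n} (-1)^{n-|I|} H_I(s). Assume: (i) for every index i ∈ Fin n, every subset I with i ∉ I, and every s with s i > N, one has H_{I ∪ {i}}(s) = H_I(s); and (ii) h'(-s) = h'(s) for all s. Then h'(s) = 0 whenever |s i| > N for some index i; in particular, h' vanishes outside the finite box {s : ∀ i, -N ≤ s i ≤ N}, so h' is finitely supported. -/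
/-- An alternating sum over the subsets of `S` vanishes when inserting a fixed element
`i ∈ S` does not change the summands. -/
theorem sum_powerset_neg_one_pow_mul_eq_zero {α R : Type*} [DecidableEq α] [Ring R]
    {S : Finset α} {i : α} (hi : i ∈ S) (f : Finset α → R)
    (hf : ∀ I ⊆ S, i ∉ I → f (insert i I) = f I) :
    ∑ I ∈ S.powerset, (-1 : R) ^ (S.card - I.card) * f I = 0 := by
  have hS := Finset.card_erase_add_one hi
  conv_lhs => rw [← Finset.insert_erase hi]
  rw [Finset.sum_powerset_insert (Finset.notMem_erase i S), ← Finset.sum_add_distrib]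
  refine Finset.sum_eq_zero fun I hI => ?_
  rw [Finset.mem_powerset] at hI
  have hiI : i ∉ I := fun h => Finset.notMem_erase i S (hI h)
  have hcard := Finset.card_le_card hI
  rw [Finset.insert_erase hi, hf I (hI.trans (Finset.erase_subset i S)) hiI,
    Finset.card_insert_of_notMem hiI,
    show S.card - I.card = S.card - (I.card + 1) + 1 by omega, pow_succ]
  simp

/-- If the subset-indexed functions `H I` stabilize when some coordinate
exceeds `N` (adding that index to `I` does not change the value), and the alternating
sum `h'` is symmetric under `s ↦ -s`, then `h'` vanishes whenever some `|s i| > N`;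
in particular `h'` is finitely supported. -/
theorem alternating_sum_finitely_supported (n : ℕ) (hn : 1 ≤ n) (N : ℕ)
    (H : Finset (Fin n) → (Fin n → ℤ) → ℤ)
    (h' : (Fin n → ℤ) → ℤ)
    (hdef : ∀ s : Fin n → ℤ,
      h' s = ∑ I ∈ (Finset.univ : Finset (Fin n)).powerset,
        (-1 : ℤ) ^ (n - I.card) * H I s)
    (hstab : ∀ (i : Fin n) (I : Finset (Fin n)), i ∉ I →
      ∀ s : Fin n → ℤ, (N : ℤ) < s i → H (insert i I) s = H I s)
    (hsymm : ∀ s : Fin n → ℤ, h' (-s) = h' s) :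
    (∀ s : Fin n → ℤ, (∃ i : Fin n, (N : ℤ) < |s i|) → h' s = 0) ∧
      (Function.support h').Finite := by
  have hpos : ∀ (s : Fin n → ℤ) (i : Fin n), (N : ℤ) < s i → h' s = 0 := by
    intro s i hi
    rw [hdef]
    simpa using sum_powerset_neg_one_pow_mul_eq_zero (Finset.mem_univ i) (fun I => H I s)
      fun I _ hiI => hstab i I hiI s hi
  have hzero : ∀ s : Fin n → ℤ, (∃ i : Fin n, (N : ℤ) < |s i|) → h' s = 0 := by
    rintro s ⟨i, hi⟩
    rcases lt_abs.mp hi with h | h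
    · exact hpos s i h
    · rw [← hsymm]
      exact hpos (-s) i h
  refine ⟨hzero, (Set.finite_Icc (fun _ => -(N : ℤ)) (fun _ => (N : ℤ))).subset fun s hs => ?_⟩
  have hbox : ∀ i, |s i| ≤ N := fun i => not_lt.mp fun h => hs (hzero s ⟨i, h⟩)
  exact ⟨fun i => (abs_le.mp (hbox i)).1, fun i => (abs_le.mp (hbox i)).2⟩
end

section
/- Let n ≥ 1 and let c, q : (Fin n → ℤ) → ℤ be finitely supported functions. Suppose that for every s : Fin n → ℤ, Σ_{J ⊆ Fin n} (-1)^{n-|J|} q(s - e_J) = Σ_{J ⊆ Fin n} (-1)^{|J|} c(s - e_J), where e_J : Fin n → ℤ is the indicator vector of the subset J. Then q(s) = (-1)^n c(s) for all s. -/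
/-- A finitely supported function on `ι → ℤ` whose alternating sum over every unit cube vanishes
is zero. -/
theorem eq_zero_of_alternating_cube_sum_eq_zero {ι R : Type*} [Fintype ι] [DecidableEq ι] [Ring R]
    {f : (ι → ℤ) → R} (hf : (Function.support f).Finite)
    (hsum : ∀ s : ι → ℤ, ∑ J : Finset ι,
      (-1 : R) ^ J.card * f (s - fun i => if i ∈ J then 1 else 0) = 0) :
    f = 0 := by
  by_contra hne
  obtain ⟨m, hm⟩ := hf.exists_minimal (Function.support_nonempty_iff.mpr hne)
  have hvanish : ∀ J : Finset ι, J ≠ ∅ →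
      (-1 : R) ^ J.card * f (m - fun i => if i ∈ J then 1 else 0) = 0 := by
    intro J hJ
    obtain ⟨j, hj⟩ := Finset.nonempty_iff_ne_empty.mpr hJ
    by_contra hmem
    have hle : (m - fun i => if i ∈ J then 1 else 0) ≤ m := by
      intro i
      simp only [Pi.sub_apply]
      split_ifs <;> omega
    have hge := hm.2 (Function.mem_support.mpr (right_ne_zero_of_mul hmem)) hle j
    simp only [Pi.sub_apply, if_pos hj] at hge
    omega
  have h := hsum m
  rw [Fintype.sum_eq_single ∅ hvanish] at h
  refine hm.1 ?_
  simpa [← Pi.zero_def] using h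

/-- If two finitely supported functions `q` and `c` satisfy
`∑_J (-1)^(n-|J|) q (s - e_J) = ∑_J (-1)^(|J|) c (s - e_J)` for all `s`, then
`q = (-1)^n • c`. -/
theorem finitely_supported_recursion_unique (n : ℕ) (hn : 1 ≤ n)
    (c q : (Fin n → ℤ) → ℤ)
    (hc : (Function.support c).Finite) (hq : (Function.support q).Finite)
    (hrec : ∀ s : Fin n → ℤ,
      ∑ J ∈ (Finset.univ : Finset (Fin n)).powerset,
          (-1 : ℤ) ^ (n - J.card) * q (s - fun i => if i ∈ J then 1 else 0)
        = ∑ J ∈ (Finset.univ : Finset (Fin n)).powerset,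
            (-1 : ℤ) ^ J.card * c (s - fun i => if i ∈ J then 1 else 0)) :
    ∀ s : Fin n → ℤ, q s = (-1 : ℤ) ^ n * c s := by
  have hd := eq_zero_of_alternating_cube_sum_eq_zero
    (f := fun s => q s - (-1 : ℤ) ^ n * c s)
    ((hq.union hc).subset fun s hs => by
      by_contra h
      simp_all) fun s => by
    have hsign : ∀ J : Finset (Fin n), (-1 : ℤ) ^ J.card = (-1) ^ n * (-1) ^ (n - J.card) := by
      intro J
      have hJ : J.card ≤ n := by simpa using J.card_le_univ
      rw [← pow_add, show n + (n - J.card) = 2 * (n - J.card) + J.card by omega, pow_add, pow_mul]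
      simp
    have h := hrec s
    rw [Finset.powerset_univ] at h
    simp only [mul_sub, Finset.sum_sub_distrib, mul_left_comm _ ((-1 : ℤ) ^ n), ← Finset.mul_sum]
    rw [← h, Finset.mul_sum, sub_eq_zero]
    exact Finset.sum_congr rfl fun J _ => by rw [hsign J, mul_assoc]
  intro s
  exact sub_eq_zero.mp (congrFun hd s)
end

section
/- Let h : (Fin 3 → ℤ) → ℤ be finitely supported (nonzero at only finitely many points) and satisfy: (i) h(s) ≥ 0 for all s; (ii) h(-s) = h(s) for all s; (iii) h is monotone toward the origin, i.e. for every s and index i, h(s - e_i) ≥ h(s) whenever s i > 0, and h(s - e_i) ≤ h(s) whenever s i ≤ 0, where e_i is the i-th standard basis vector; and (iv) |h(s) - h(s - e_i)| ≤ 1 for all s and i. If Σ_s h(s) is even, then either Σ_s h(s) = 0 or Σ_s h(s) ≥ 8. In particular Σ_s h(s) ≠ 4. -/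
/-- A function on `ℤ^ι` that does not decrease along lattice steps toward the origin attains its
maximum at the origin. -/
theorem le_apply_zero_of_monotone_toward_zero {ι : Type*} [Fintype ι] [DecidableEq ι]
    (h : (ι → ℤ) → ℤ)
    (hpos : ∀ (s : ι → ℤ) (i : ι), 0 < s i → h s ≤ h (s - Pi.single i 1))
    (hneg : ∀ (s : ι → ℤ) (i : ι), s i < 0 → h s ≤ h (s + Pi.single i 1)) (s : ι → ℤ) :
    h s ≤ h 0 := by
  induction hn : ∑ i, (s i).natAbs using Nat.strong_induction_on generalizing s with
  | _ n ih =>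
    subst hn
    by_cases hs : s = 0
    · rw [hs]
    obtain ⟨i, hi⟩ := Function.ne_iff.mp hs
    rw [Pi.zero_apply] at hi
    rcases lt_or_gt_of_ne hi with hi | hi
    · refine (hneg s i hi).trans (ih _ (Finset.sum_lt_sum (fun j _ => ?_) ⟨i, by simp, ?_⟩) _ rfl)
      · rcases eq_or_ne j i with rfl | hj
        · simp only [Pi.add_apply, Pi.single_eq_same]; omega
        · simp [hj]
      · simp only [Pi.add_apply, Pi.single_eq_same]; omega
    · refine (hpos s i hi).trans (ih _ (Finset.sum_lt_sum (fun j _ => ?_) ⟨i, by simp, ?_⟩) _ rfl)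
      · rcases eq_or_ne j i with rfl | hj
        · simp only [Pi.sub_apply, Pi.single_eq_same]; omega
        · simp [hj]
      · simp only [Pi.sub_apply, Pi.single_eq_same]; omega

/-- The sum of a finitely supported even function has the same parity as its value at zero. -/
theorem even_sum_support_iff_even_apply_zero {G : Type*} [AddGroup G]
    (hG : ∀ g : G, -g = g → g = 0) (h : G → ℤ) (hf : (Function.support h).Finite)
    (hsymm : ∀ s, h (-s) = h s) :
    Even (∑ s ∈ hf.toFinset, h s) ↔ Even (h 0) := by
  classical
  have key : ∑ s ∈ hf.toFinset.erase 0, (h s : ZMod 2) = 0 := by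
    refine Finset.sum_involution (fun s _ => -s) (fun s _ => ?_) (fun s hs _ hss => ?_)
      (fun s hs => ?_) (fun s _ => neg_neg s)
    · rw [hsymm, CharTwo.add_self_eq_zero]
    · exact (Finset.mem_erase.mp hs).1 (hG s hss)
    · simpa [hsymm] using hs
  have hsum : ∑ s ∈ hf.toFinset, h s = ∑ s ∈ hf.toFinset.erase 0, h s + h 0 := by
    by_cases h0 : h 0 = 0
    · rw [Finset.sum_erase _ h0, h0, add_zero]
    · exact (Finset.sum_erase_add _ _ (by simpa using h0)).symm
  have heven : Even (∑ s ∈ hf.toFinset.erase 0, h s) := by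
    rw [even_iff_two_dvd]
    exact (ZMod.intCast_zmod_eq_zero_iff_dvd _ 2).mp (by push_cast; exact key)
  rw [hsum, Int.even_add]
  simp [heven]


/-- For a finitely supported, nonnegative, symmetric function
`h : ℤ^3 → ℤ` that is monotone toward the origin and changes by at most 1 along each
lattice step, if the total sum is even then it is `0` or at least `8`;
in particular the total sum is never `4`. -/
theorem sum_h_even_eq_zero_or_ge_eight
    (h : (Fin 3 → ℤ) → ℤ) (hf : (Function.support h).Finite)
    (hnonneg : ∀ s : Fin 3 → ℤ, 0 ≤ h s)
    (hsymm : ∀ s : Fin 3 → ℤ, h (-s) = h s)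
    (hmono₁ : ∀ (s : Fin 3 → ℤ) (i : Fin 3), 0 < s i →
      h s ≤ h (s - fun j => if j = i then 1 else 0))
    (hmono₂ : ∀ (s : Fin 3 → ℤ) (i : Fin 3), s i ≤ 0 →
      h (s - fun j => if j = i then 1 else 0) ≤ h s)
    (hstep : ∀ (s : Fin 3 → ℤ) (i : Fin 3),
      |h s - h (s - fun j => if j = i then 1 else 0)| ≤ 1) :
    (Even (∑ s ∈ hf.toFinset, h s) →
      (∑ s ∈ hf.toFinset, h s = 0 ∨ 8 ≤ ∑ s ∈ hf.toFinset, h s)) ∧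
      (∑ s ∈ hf.toFinset, h s) ≠ 4 := by
  have hsingle (i : Fin 3) : (fun j => if j = i then 1 else 0) = (Pi.single i 1 : Fin 3 → ℤ) := by
    ext j
    simp [Pi.single_apply]
  simp only [hsingle] at hmono₁ hmono₂ hstep
  have hmax := le_apply_zero_of_monotone_toward_zero h hmono₁ fun s i hi => by
    have hstep_in := hmono₂ (s + Pi.single i 1) i (by simpa using hi)
    rwa [add_sub_cancel_right] at hstep_in
  have hparity := even_sum_support_iff_even_apply_zero
    (fun g hg => self_eq_neg.mp hg.symm) h hf hsymm
  have main : Even (∑ s ∈ hf.toFinset, h s) →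
      (∑ s ∈ hf.toFinset, h s = 0 ∨ 8 ≤ ∑ s ∈ hf.toFinset, h s) := by
    intro he
    have h0 := hparity.mp he
    rcases (hnonneg 0).eq_or_lt with hz | hz
    · exact Or.inl (Finset.sum_eq_zero fun s _ => le_antisymm (hz ▸ hmax s) (hnonneg s))
    right
    have h2 : 2 ≤ h 0 := by
      obtain ⟨k, hk⟩ := h0
      omega
    have hm (i : Fin 3) : 1 ≤ h (-Pi.single i 1) := by
      have := (abs_le.mp (hstep 0 i)).2
      rw [zero_sub] at this
      omega
    have hp (i : Fin 3) : 1 ≤ h (Pi.single i 1) := hsymm (Pi.single i 1) ▸ hm i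
    let T : Finset (Fin 3 → ℤ) := {0, Pi.single 0 1, Pi.single 1 1, Pi.single 2 1,
      -Pi.single 0 1, -Pi.single 1 1, -Pi.single 2 1}
    have hT : T ⊆ hf.toFinset := by
      intro s hs
      rw [Set.Finite.mem_toFinset, Function.mem_support]
      simp only [T, Finset.mem_insert, Finset.mem_singleton] at hs
      have hp0 := hp 0
      have hp1 := hp 1
      have hp2 := hp 2
      rcases hs with rfl | rfl | rfl | rfl | rfl | rfl | rfl <;> (try rw [hsymm]) <;> omega
    have hcard : T.card = 7 := by decide
    have h0T : (0 : Fin 3 → ℤ) ∈ T := Finset.mem_insert_self _ _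
    calc (8 : ℤ) = ∑ s ∈ T.erase 0, 1 + 2 := by
          rw [Finset.sum_const, Finset.card_erase_of_mem h0T, hcard]
          rfl
      _ ≤ ∑ s ∈ T.erase 0, h s + h 0 := by
          refine add_le_add (Finset.sum_le_sum fun s hs => ?_) h2
          have hs' := Set.Finite.mem_toFinset hf |>.mp (hT (Finset.mem_of_mem_erase hs))
          exact (hnonneg s).lt_of_ne' hs'
      _ = ∑ s ∈ T, h s := Finset.sum_erase_add _ _ h0T
      _ ≤ ∑ s ∈ hf.toFinset, h s :=
          Finset.sum_le_sum_of_subset_of_nonneg hT fun s _ _ => hnonneg s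
  refine ⟨main, fun h4 => ?_⟩
  have := main (h4 ▸ by decide)
  omega
end
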